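/- Let ξ = (ξ_1,…,ξ_r) be a centered Gaussian vector with Var(ξ_j) = w_{j,j} ≤ σ² for all j. Then for any ε > 0 and x > 0, P(x - ε < max_j |ξ_j| ≤ x + ε) ≤ C ε √(log(2r))/σ' for a universal constant C, where σ' = min_j √(w_{j,j}) (assuming σ' > 0). Equivalently, the distribution function of max_j |ξ_j| has modulus of continuity of order ε√(log r). -/

import Mathlib

open MeasureTheory Matrix ProbabilityTheory

lemma aux_pdf (x : ℝ) : gaussianPDFReal 0 1 x = (Real.sqrt (2 * Real.pi))⁻¹ * Real.exp (-(x^2/2)) := by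
  simp only [gaussianPDFReal, NNReal.coe_one, mul_one, sub_zero, neg_div]

lemma aux_deriv (x : ℝ) : HasDerivAt (fun y => -gaussianPDFReal 0 1 y) (x * gaussianPDFReal 0 1 x) x := by
  have h : (fun y => -gaussianPDFReal 0 1 y)
      = fun y => -((Real.sqrt (2 * Real.pi))⁻¹ * Real.exp (-(y^2/2))) := by
    funext y; rw [aux_pdf]
  rw [h, aux_pdf]
  have h1 : HasDerivAt (fun y : ℝ => -(y^2/2)) (-x) x := by
    have := ((hasDerivAt_pow 2 x).div_const 2).neg
    exact this.congr_deriv (by norm_num)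
  exact (((h1.exp).const_mul ((Real.sqrt (2 * Real.pi))⁻¹)).neg).congr_deriv (by ring)

lemma aux_anti {x y : ℝ} (hx : 0 ≤ x) (hxy : x ≤ y) :
    gaussianPDFReal 0 1 y ≤ gaussianPDFReal 0 1 x := by
  rw [aux_pdf, aux_pdf]
  gcongr

lemma aux_cont : Continuous (gaussianPDFReal 0 1) := by
  have : gaussianPDFReal 0 1 = fun y => (Real.sqrt (2 * Real.pi))⁻¹ * Real.exp (-(y^2/2)) := by
    funext y; rw [aux_pdf]
  rw [this]; fun_prop

lemma aux_tail {c v : ℝ} (hc : 0 ≤ c) :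
    gaussianPDFReal 0 1 v ≤ c * (gaussianReal 0 1).real (Set.Ici v) + gaussianPDFReal 0 1 c := by
  rcases le_total c v with h | h
  · have := aux_anti hc h
    have : 0 ≤ c * (gaussianReal 0 1).real (Set.Ici v) := by positivity
    linarith
  · have h1 : ∫ x in v..c, x * gaussianPDFReal 0 1 x
        = -gaussianPDFReal 0 1 c - -gaussianPDFReal 0 1 v :=
      intervalIntegral.integral_eq_sub_of_hasDerivAt (fun x _ => aux_deriv x)
        ((continuous_id.mul aux_cont).intervalIntegrable _ _)
    have h2 : ∫ x in v..c, x * gaussianPDFReal 0 1 x ≤ ∫ x in v..c, c * gaussianPDFReal 0 1 x := by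
      apply intervalIntegral.integral_mono_on h ((continuous_id.mul aux_cont).intervalIntegrable _ _)
        ((continuous_const.mul aux_cont).intervalIntegrable _ _)
      intro x hx
      exact mul_le_mul_of_nonneg_right hx.2 (gaussianPDFReal_nonneg _ _ _)
    have h3 : ∫ x in v..c, gaussianPDFReal 0 1 x ≤ (gaussianReal 0 1).real (Set.Ici v) := by
      rw [intervalIntegral.integral_of_le h, Measure.real,
        gaussianReal_apply_eq_integral _ one_ne_zero, ENNReal.toReal_ofReal]
      · apply setIntegral_mono_set (integrable_gaussianPDFReal 0 1).integrableOn
        · exact Filter.Eventually.of_forall fun x => gaussianPDFReal_nonneg _ _ _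
        · exact Filter.Eventually.of_forall fun x hx => le_of_lt hx.1
      · exact integral_nonneg fun x => gaussianPDFReal_nonneg _ _ _
    rw [intervalIntegral.integral_const_mul] at h2
    have := mul_le_mul_of_nonneg_left h3 hc
    linarith

lemma aux_up {c v : ℝ} (hc : 0 ≤ c) {S : Set ℝ} (hS : IsUpperSet S) (hv : v ∈ S) :
    gaussianPDFReal 0 1 v ≤ c * (gaussianReal 0 1).real S + gaussianPDFReal 0 1 c := by
  have h1 : gaussianPDFReal 0 1 v ≤ gaussianPDFReal 0 1 (max v 0) := by
    rcases le_total v 0 with h | h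
    · rw [max_eq_right h, aux_pdf, aux_pdf]
      have : -(v^2/2) ≤ -((0:ℝ)^2/2) := by nlinarith [sq_nonneg v]
      exact mul_le_mul_of_nonneg_left (Real.exp_le_exp.2 this) (by positivity)
    · rw [max_eq_left h]
  have h2 := aux_tail (v := max v 0) hc
  have h3 : (gaussianReal 0 1).real (Set.Ici (max v 0)) ≤ (gaussianReal 0 1).real S :=
    measureReal_mono fun x hx => hS ((le_max_left v 0).trans hx) hv
  have := mul_le_mul_of_nonneg_left h3 hc
  linarith

lemma aux_slice {c b δ : ℝ} (hc : 0 ≤ c) {S : Set ℝ} (hS : IsUpperSet S)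
    (hm : MeasurableSet S) :
    gaussianReal 0 1 (S ∩ Set.Ioc b (b + δ)) ≤
      (ENNReal.ofReal c * gaussianReal 0 1 S + ENNReal.ofReal (gaussianPDFReal 0 1 c))
        * ENNReal.ofReal δ := by
  rw [gaussianReal_apply _ one_ne_zero]
  calc _ ≤ ∫⁻ x in S ∩ Set.Ioc b (b + δ), (ENNReal.ofReal c * gaussianReal 0 1 S + ENNReal.ofReal (gaussianPDFReal 0 1 c)) := by
        apply setLIntegral_mono' (hm.inter measurableSet_Ioc)
        intro x hx
        rw [gaussianPDF, ← ofReal_measureReal, ← ENNReal.ofReal_mul hc, ← ENNReal.ofReal_add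
          (by positivity) (gaussianPDFReal_nonneg _ _ _)]
        exact ENNReal.ofReal_le_ofReal (aux_up hc hS hx.1)
    _ ≤ _ := by
        rw [setLIntegral_const]
        gcongr
        calc _ ≤ volume (Set.Ioc b (b + δ)) := measure_mono Set.inter_subset_right
          _ = _ := by simp

/-- tie-broken argmax -/
def auxArg {ι : Type*} (e : ι → ℕ) (i : ι) (y : ι → ℝ) : Prop :=
  ∀ j, y j ≤ y i ∧ (e j < e i → y j < y i)

lemma aux_exists {ι : Type*} [Fintype ι] [Nonempty ι] (e : ι → ℕ)
    (y : ι → ℝ) : ∃ i, auxArg e i y := by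
  obtain ⟨i, hi⟩ := Finite.exists_max y
  obtain ⟨k, hk, hk'⟩ := Set.exists_min_image {k | y k = y i} e (Set.toFinite _) ⟨i, rfl⟩
  refine ⟨k, fun j => ⟨(hi j).trans_eq hk.symm, fun h => ?_⟩⟩
  refine lt_of_le_of_ne ((hi j).trans_eq hk.symm) fun h' => ?_
  have := hk' j (h'.trans hk)
  omega

lemma aux_unique {ι : Type*} {e : ι → ℕ} (he : Function.Injective e)
    {y : ι → ℝ} {i j : ι} (hi : auxArg e i y) (hj : auxArg e j y) : i = j := by
  by_contra h
  rcases lt_or_gt_of_ne (he.ne h) with h' | h'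
  · exact absurd ((hj i).2 h') (not_lt.2 (hi j).1)
  · exact absurd ((hi j).2 h') (not_lt.2 (hj i).1)

lemma aux_one {Ω ι : Type*} [MeasurableSpace Ω] [Fintype ι] (μ : Measure Ω) [IsProbabilityMeasure μ]
    (X : ι → Ω → ℝ) (hX : HasGaussianLaw (fun ω => (X · ω)) μ)
    (h1 : ∀ i, μ.map (X i) = gaussianReal 0 1) (e : ι → ℕ) (b : ι → ℝ) (i : ι) {c δ : ℝ} (hc : 0 ≤ c) :
    μ {ω | auxArg e i (fun j => X j ω - b j) ∧ X i ω ∈ Set.Ioc (b i) (b i + δ)} ≤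
      (ENNReal.ofReal c * μ {ω | auxArg e i (fun j => X j ω - b j)}
        + ENNReal.ofReal (gaussianPDFReal 0 1 c)) * ENNReal.ofReal δ := by
  have hL : ∀ j, MemLp (X j) 2 μ := fun j => (hX.eval j).memLp_two
  have hvar : ∀ j, Var[X j; μ] = 1 := fun j => by
    have := variance_map (X := id) (μ := μ) (Y := X j) (by fun_prop) (hX.eval j).aemeasurable
    rw [h1] at this
    simpa using this.symm
  set ρ : ι → ℝ := fun j => cov[X i, X j; μ] with hρ
  have hρ1 : ∀ j, ρ j ≤ 1 := fun j => by
    have h := variance_nonneg (X i - X j) μ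
    rw [variance_sub (hL i) (hL j), hvar, hvar] at h
    change cov[X i, X j; μ] ≤ 1
    linarith
  let R : ι → Ω → ℝ := fun j ω => X j ω - ρ j * X i ω
  have hG : HasGaussianLaw (fun ω => ((fun _ : Unit => X i ω), (fun j => R j ω))) μ := by
    let L : (ι → ℝ) →L[ℝ] (Unit → ℝ) × (ι → ℝ) :=
      (ContinuousLinearMap.pi fun _ => ContinuousLinearMap.proj i).prod
        (ContinuousLinearMap.pi fun j => ContinuousLinearMap.proj j - ρ j • ContinuousLinearMap.proj i)
    exact hX.map_fun L
  have hI0 := HasGaussianLaw.indepFun_of_covariance_eval (X := fun _ : Unit => X i) (Y := R) hG (by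
    intro _ j
    change cov[X i, fun ω => X j ω - ρ j * X i ω; μ] = 0
    rw [covariance_fun_sub_right (hL i) (hL j) ((hL i).const_mul _), covariance_const_mul_right,
      covariance_self (hL i).aemeasurable, hvar, hρ]
    simp)
  have hI : IndepFun (X i) (fun ω j => R j ω) μ :=
    hI0.comp (φ := fun f : Unit → ℝ => f ()) (ψ := id) (by fun_prop) measurable_id
  have mX : AEMeasurable (X i) μ := (hX.eval i).aemeasurable
  have mR : AEMeasurable (fun ω j => R j ω) μ := hG.snd.aemeasurable
  have hmap := (indepFun_iff_map_prod_eq_prod_map_map mX mR).1 hI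
  rw [h1] at hmap
  set ν := μ.map (fun ω j => R j ω) with hν
  have : IsProbabilityMeasure ν := Measure.isProbabilityMeasure_map mR
  let B : Set (ℝ × (ι → ℝ)) := {p | ∀ j, ρ j * p.1 + p.2 j - b j ≤ p.1 - b i ∧
    (e j < e i → ρ j * p.1 + p.2 j - b j < p.1 - b i)}
  have hB : MeasurableSet B := by
    simp only [B, Set.ofPred_forall, Set.ofPred_and]
    refine MeasurableSet.iInter fun j => MeasurableSet.inter ?_ (MeasurableSet.iInter fun _ => ?_)
    · exact measurableSet_le (by fun_prop) (by fun_prop)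
    · exact measurableSet_lt (by fun_prop) (by fun_prop)
  have hA : MeasurableSet (B ∩ Set.Ioc (b i) (b i + δ) ×ˢ Set.univ) :=
    hB.inter (measurableSet_Ioc.prod MeasurableSet.univ)
  have e1 : μ {ω | auxArg e i (fun j => X j ω - b j)} = ((gaussianReal 0 1).prod ν) B := by
    rw [← hmap, Measure.map_apply_of_aemeasurable (mX.prodMk mR) hB]
    congr 1
    ext ω
    simp [B, R, auxArg]
  have e2 : μ {ω | auxArg e i (fun j => X j ω - b j) ∧ X i ω ∈ Set.Ioc (b i) (b i + δ)}
      = ((gaussianReal 0 1).prod ν) (B ∩ Set.Ioc (b i) (b i + δ) ×ˢ Set.univ) := by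
    rw [← hmap, Measure.map_apply_of_aemeasurable (mX.prodMk mR) hA]
    congr 1
    ext ω
    simp [B, R, auxArg]
  rw [e1, e2, Measure.prod_apply_symm hA, Measure.prod_apply_symm hB]
  calc _ ≤ ∫⁻ y, (ENNReal.ofReal c * gaussianReal 0 1 ((fun x => (x, y)) ⁻¹' B)
        + ENNReal.ofReal (gaussianPDFReal 0 1 c)) * ENNReal.ofReal δ ∂ν := by
        apply lintegral_mono
        intro y
        have hup : IsUpperSet ((fun x => (x, y)) ⁻¹' B) := by
          intro u v huv hu j
          have hu' := hu j
          have := mul_le_mul_of_nonneg_left huv (sub_nonneg.2 (hρ1 j))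
          simp only at hu' ⊢
          refine ⟨by linarith [hu'.1], fun h => by linarith [hu'.2 h]⟩
        have := aux_slice (b := b i) (δ := δ) hc hup (hB.preimage (by fun_prop))
        convert this using 2
        ext x; simp
    _ = _ := by
        have hm : Measurable fun y => gaussianReal 0 1 ((fun x => (x, y)) ⁻¹' B) :=
          measurable_measure_prodMk_right hB
        rw [lintegral_mul_const' _ _ ENNReal.ofReal_ne_top, lintegral_add_right _ measurable_const,
          lintegral_const_mul _ hm]
        simp

lemma aux_main {Ω ι : Type*} [MeasurableSpace Ω] [Fintype ι] [Nonempty ι] (μ : Measure Ω) [IsProbabilityMeasure μ]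
    (X : ι → Ω → ℝ) (hX : HasGaussianLaw (fun ω => (X · ω)) μ)
    (h1 : ∀ i, μ.map (X i) = gaussianReal 0 1) (b : ι → ℝ) {c δ : ℝ} (hc : 0 ≤ c) (hδ : 0 ≤ δ) :
    μ.real {ω | (∃ i, b i < X i ω) ∧ ∀ i, X i ω ≤ b i + δ} ≤
      (c + Fintype.card ι * gaussianPDFReal 0 1 c) * δ := by
  classical
  let e : ι → ℕ := fun i => (Fintype.equivFin ι i : ℕ)
  have he : Function.Injective e := Fin.val_injective.comp (Fintype.equivFin ι).injective
  let B : ι → Set Ω := fun i => {ω | auxArg e i (fun j => X j ω - b j)}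
  have hdis : Pairwise (Function.onFun (AEDisjoint μ) B) := by
    intro i j hij
    apply Disjoint.aedisjoint
    rw [Set.disjoint_left]
    intro ω hi hj
    exact hij (aux_unique he hi hj)
  have hBm : ∀ i, NullMeasurableSet (B i) μ := by
    intro i
    have : ∀ j, AEMeasurable (X j) μ := fun j => (hX.eval j).aemeasurable
    simp only [B, auxArg, Set.ofPred_forall, Set.ofPred_and]
    refine NullMeasurableSet.iInter fun j => NullMeasurableSet.inter ?_ (NullMeasurableSet.iInter fun _ => ?_)
    · exact nullMeasurableSet_le ((this _).sub_const _) ((this _).sub_const _)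
    · exact nullMeasurableSet_lt ((this _).sub_const _) ((this _).sub_const _)
  have hsum : ∑ i, μ (B i) ≤ 1 := by
    rw [← tsum_fintype (L := .unconditional _), ← measure_iUnion₀ hdis hBm]
    exact prob_le_one
  have hmain : μ {ω | (∃ i, b i < X i ω) ∧ ∀ i, X i ω ≤ b i + δ} ≤
      (ENNReal.ofReal c + Fintype.card ι * ENNReal.ofReal (gaussianPDFReal 0 1 c)) * ENNReal.ofReal δ := by
    calc _ ≤ μ (⋃ i, {ω | auxArg e i (fun j => X j ω - b j) ∧ X i ω ∈ Set.Ioc (b i) (b i + δ)}) := by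
          apply measure_mono
          rintro ω ⟨⟨j, hj⟩, h⟩
          obtain ⟨i, hi⟩ := aux_exists e (fun j => X j ω - b j)
          refine Set.mem_iUnion.2 ⟨i, hi, ?_, h i⟩
          have := (hi j).1
          simp only at this
          linarith
      _ ≤ ∑ i, μ {ω | auxArg e i (fun j => X j ω - b j) ∧ X i ω ∈ Set.Ioc (b i) (b i + δ)} :=
          measure_iUnion_fintype_le _ _
      _ ≤ ∑ i, (ENNReal.ofReal c * μ (B i)
        + ENNReal.ofReal (gaussianPDFReal 0 1 c)) * ENNReal.ofReal δ :=
          Finset.sum_le_sum fun i _ => aux_one μ X hX h1 e b i hc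
      _ = (ENNReal.ofReal c * ∑ i, μ (B i) + Fintype.card ι * ENNReal.ofReal (gaussianPDFReal 0 1 c)) * ENNReal.ofReal δ := by
          rw [← Finset.sum_mul, Finset.sum_add_distrib, Finset.mul_sum]
          simp
      _ ≤ (ENNReal.ofReal c * 1 + Fintype.card ι * ENNReal.ofReal (gaussianPDFReal 0 1 c)) * ENNReal.ofReal δ := by
          gcongr
      _ = _ := by rw [mul_one]
  have hp := gaussianPDFReal_nonneg 0 1 c
  rw [Measure.real]
  apply ENNReal.toReal_le_of_le_ofReal (by positivity)
  rw [ENNReal.ofReal_mul (by positivity), ENNReal.ofReal_add hc (by positivity),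
    ENNReal.ofReal_mul (by positivity), ENNReal.ofReal_natCast]
  exact hmain

/-- Gaussian anti-concentration for the maximum of absolute values of a centered Gaussian
vector: there is a universal constant `C` such that
`P(x - ε < max_j |ξ_j| ≤ x + ε) ≤ C ε √(log(2r)) / min_j √(w_{j,j})`. -/
theorem gaussian_max_anticoncentration :
    ∃ C : ℝ, 0 < C ∧
      ∀ (r : ℕ), 0 < r →
      ∀ (Ω : Type) [MeasurableSpace Ω] (μ : Measure Ω) [IsProbabilityMeasure μ]
        (ξ : Ω → Fin r → ℝ) (W : Matrix (Fin r) (Fin r) ℝ) (σ : ℝ),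
        W.PosDef →
        (∀ a : Fin r → ℝ,
          Measure.map (fun ω => ∑ j, a j * ξ ω j) μ
            = gaussianReal 0 (Real.toNNReal (a ⬝ᵥ W.mulVec a))) →
        (∀ j, W j j ≤ σ ^ 2) →
        (0 < ⨅ j, Real.sqrt (W j j)) →
        ∀ ε x : ℝ, 0 < ε → 0 < x →
          (μ {ω | x - ε < (⨆ j, |ξ ω j|) ∧ (⨆ j, |ξ ω j|) ≤ x + ε}).toReal
            ≤ C * ε * Real.sqrt (Real.log (2 * r)) / ⨅ j, Real.sqrt (W j j) := by
  refine ⟨6, by norm_num, ?_⟩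
  intro r hr Ω _ μ _ ξ W σ _ hW _ hs ε x hε _
  have : Nonempty (Fin r) := ⟨⟨0, hr⟩⟩
  set s := ⨅ j, Real.sqrt (W j j) with hsdef
  have hsj : ∀ j, s ≤ Real.sqrt (W j j) := fun j => ciInf_le (Set.finite_range _).bddBelow j
  have hpos : ∀ j, 0 < Real.sqrt (W j j) := fun j => hs.trans_le (hsj j)
  have hmap1 : ∀ j, μ.map (fun ω => ξ ω j) = gaussianReal 0 (Real.toNNReal (W j j)) := by
    intro j
    have := hW (Pi.single j 1)
    simpa [Pi.single_apply] using this
  have hmeas : ∀ j, AEMeasurable (fun ω => ξ ω j) μ := fun j =>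
    AEMeasurable.of_map_ne_zero (by rw [hmap1]; exact IsProbabilityMeasure.ne_zero _)
  have hmeasξ : AEMeasurable ξ μ := aemeasurable_pi_lambda _ hmeas
  have hgauss : HasGaussianLaw ξ μ := by
    constructor
    constructor
    intro L
    have hLeq : (fun ω => L (ξ ω)) = fun ω => ∑ j, L (Pi.single j 1) * ξ ω j := by
      funext ω
      conv_lhs => rw [pi_eq_sum_univ' (ξ ω)]
      rw [map_sum]
      refine Finset.sum_congr rfl fun j _ => ?_
      rw [map_smul, smul_eq_mul, mul_comm]
    have hmL : (μ.map ξ).map L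
        = gaussianReal 0 (Real.toNNReal ((fun j => L (Pi.single j 1)) ⬝ᵥ W.mulVec (fun j => L (Pi.single j 1)))) := by
      rw [AEMeasurable.map_map_of_aemeasurable (by fun_prop) hmeasξ, ← hW, ← hLeq]
      rfl
    have hi : ∫ x, L x ∂(μ.map ξ) = 0 := by
      have : ∫ x, L x ∂(μ.map ξ) = ∫ x, x ∂((μ.map ξ).map L) := by
        rw [integral_map (φ := L) (by fun_prop) (by fun_prop)]
      rw [this, hmL, integral_id_gaussianReal]
    have hv : Var[L; μ.map ξ] = Var[id; (μ.map ξ).map L] := by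
      rw [variance_map (Y := L) (by fun_prop) (by fun_prop)]; rfl
    rw [hi, hv, hmL, variance_id_gaussianReal, Real.toNNReal_coe]
  let sg : Bool → ℝ := fun t => if t then 1 else -1
  have hsg : ∀ t, sg t ^ 2 = 1 := by intro t; cases t <;> simp [sg]
  let X : Fin r × Bool → Ω → ℝ := fun p ω => (sg p.2 / Real.sqrt (W p.1 p.1)) * ξ ω p.1
  have hX : HasGaussianLaw (fun ω => (X · ω)) μ :=
    hgauss.map_fun (ContinuousLinearMap.pi fun p : Fin r × Bool =>
      (sg p.2 / Real.sqrt (W p.1 p.1)) •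
        (ContinuousLinearMap.proj p.1 : (Fin r → ℝ) →L[ℝ] ℝ))
  have hX1 : ∀ p, μ.map (X p) = gaussianReal 0 1 := by
    intro p
    have h := gaussianReal_map_const_mul (μ := 0) (v := Real.toNNReal (W p.1 p.1))
      (sg p.2 / Real.sqrt (W p.1 p.1))
    rw [← hmap1, AEMeasurable.map_map_of_aemeasurable (by fun_prop) (hmeas _)] at h
    have hWp : 0 < W p.1 p.1 := Real.sqrt_pos.1 (hpos _)
    refine h.trans ?_
    rw [mul_zero]
    congr 1
    · ext
      simp only [NNReal.coe_one, NNReal.coe_mul, NNReal.coe_mk, Real.coe_toNNReal _ hWp.le]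
      rw [div_pow, hsg, Real.sq_sqrt hWp.le]
      field_simp
  set c := Real.sqrt (2 * Real.log (2 * r)) with hcdef
  have hr1 : (1:ℝ) ≤ r := by exact_mod_cast hr
  have hlog : Real.log 2 ≤ Real.log (2 * r) := Real.log_le_log (by norm_num) (by linarith)
  have hlog2 := Real.log_two_gt_d9
  have key := aux_main μ X hX hX1 (fun p => (x - ε) / Real.sqrt (W p.1 p.1)) (c := c) (δ := 2 * ε / s)
    (Real.sqrt_nonneg _) (by positivity)
  have hcard : (Fintype.card (Fin r × Bool) : ℝ) * gaussianPDFReal 0 1 c ≤ 1 := by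
    rw [aux_pdf, hcdef, Real.sq_sqrt (by linarith), mul_div_cancel_left₀ _ two_ne_zero, Real.exp_neg,
      Real.exp_log (by linarith)]
    have : (Real.sqrt (2 * Real.pi))⁻¹ ≤ 1 := by
      apply inv_le_one_of_one_le₀
      rw [Real.one_le_sqrt]
      linarith [Real.pi_gt_three]
    simp only [Fintype.card_prod, Fintype.card_fin, Fintype.card_bool]
    push_cast
    calc _ = (Real.sqrt (2 * Real.pi))⁻¹ := by field_simp
      _ ≤ 1 := this
  have hbound : (c + Fintype.card (Fin r × Bool) * gaussianPDFReal 0 1 c) ≤ 3 * Real.sqrt (Real.log (2 * r)) := by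
    have hl : 0 ≤ Real.sqrt (Real.log (2 * r)) := Real.sqrt_nonneg _
    have hc1 : c = Real.sqrt 2 * Real.sqrt (Real.log (2 * r)) := by
      rw [hcdef, Real.sqrt_mul (by norm_num)]
    have hs2 : Real.sqrt 2 ≤ 1.5 := by
      rw [Real.sqrt_le_iff]; norm_num
    have h1 : (1:ℝ) ≤ 1.5 * Real.sqrt (Real.log (2 * r)) := by
      have : (2/3:ℝ) ≤ Real.sqrt (Real.log (2 * r)) := by
        apply Real.le_sqrt_of_sq_le
        norm_num at *
        linarith
      linarith
    nlinarith [mul_le_mul_of_nonneg_right hs2 hl]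
  have hsub : {ω | x - ε < (⨆ j, |ξ ω j|) ∧ (⨆ j, |ξ ω j|) ≤ x + ε} ⊆
      {ω | (∃ p : Fin r × Bool, (x - ε) / Real.sqrt (W p.1 p.1) < X p ω) ∧
        ∀ p : Fin r × Bool, X p ω ≤ (x - ε) / Real.sqrt (W p.1 p.1) + 2 * ε / s} := by
    rintro ω ⟨h1, h2⟩
    have hle : ∀ j, |ξ ω j| ≤ x + ε := fun j =>
      (le_ciSup (f := fun j => |ξ ω j|) (Set.finite_range _).bddAbove j).trans h2
    obtain ⟨j, hj⟩ := exists_lt_of_lt_ciSup h1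
    refine ⟨?_, ?_⟩
    · rcases le_total 0 (ξ ω j) with h | h
      · refine ⟨(j, true), ?_⟩
        rw [abs_of_nonneg h] at hj
        simp only [X, sg, if_true]
        rw [div_mul_eq_mul_div, one_mul]
        exact div_lt_div_of_pos_right hj (hpos j)
      · refine ⟨(j, false), ?_⟩
        rw [abs_of_nonpos h] at hj
        simp only [X, sg]
        rw [div_mul_eq_mul_div]
        apply div_lt_div_of_pos_right _ (hpos j)
        simpa using hj
    · rintro ⟨j, t⟩
      have ht : sg t * ξ ω j ≤ x + ε := by
        refine le_trans ?_ (hle j)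
        cases t
        · simpa [sg] using neg_le_abs (ξ ω j)
        · simpa [sg] using le_abs_self (ξ ω j)
      have h3 : 2 * ε / Real.sqrt (W j j) ≤ 2 * ε / s :=
        div_le_div_of_nonneg_left (by positivity) hs (hsj j)
      simp only [X]
      rw [div_mul_eq_mul_div]
      calc _ ≤ (x + ε) / Real.sqrt (W j j) := div_le_div_of_nonneg_right ht (hpos j).le
        _ = (x - ε) / Real.sqrt (W j j) + 2 * ε / Real.sqrt (W j j) := by ring
        _ ≤ _ := by linarith
  calc _ ≤ _ := measureReal_mono hsub
    _ ≤ _ := key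
    _ ≤ (3 * Real.sqrt (Real.log (2 * r))) * (2 * ε / s) := by gcongr
    _ = _ := by ring
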